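/- For even n, define (with α = 2 and using γ_{n/2} = 0) α_{n/2} = (s_{n/2+1} + s_{n/2−1})/4, β_{n/2} = (3/2)(s_{n/2} − s_1), a_{n/2} = (s_1 + α_{n/2})² − β_{n/2}², b_{n/2} = 3(s_1 + α_{n/2} + β_{n/2}), and then b = 2(b_{n/2} + α_{n/2} − s_1), c = 4(a_{n/2} − (α_{n/2} − s_1)²), m_+ = b + √(b² + c). Then, as n → ∞ through even integers, m_+/n³ → (13 + 4√10) σ, where σ = (1/(2π³)) ∑_{k=1}^{∞} 1/(2k−1)³. -/

import Mathlib

/-- The sum `s_k = (1/4) ∑_{j=1}^{n-1} sin²(k j π/n) / sin³(j π/n)`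
(Newtonian exponent `α = 2`). -/
noncomputable def sN (n k : ℕ) : ℝ :=
  (1 / 4) * ∑ j ∈ Finset.Ico 1 n,
    Real.sin ((k : ℝ) * j * Real.pi / n) ^ 2 / Real.sin ((j : ℝ) * Real.pi / n) ^ 3

/-- The constant `σ = (1/(2π³)) ∑_{k=1}^∞ 1/(2k−1)³`. -/
noncomputable def sigmaConst : ℝ :=
  (1 / (2 * Real.pi ^ 3)) * ∑' k : ℕ, 1 / (2 * (k : ℝ) + 1) ^ 3

/-- The critical mass `m₊ = b + √(b² + c)` for the ring of `n = 2m` bodies, where (with `α = 2`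
and `γ_{n/2} = 0`): `α_{n/2} = (s_{n/2+1} + s_{n/2−1})/4`, `β_{n/2} = (3/2)(s_{n/2} − s₁)`,
`a_{n/2} = (s₁ + α_{n/2})² − β_{n/2}²`, `b_{n/2} = 3(s₁ + α_{n/2} + β_{n/2})`,
`b = 2(b_{n/2} + α_{n/2} − s₁)` and `c = 4(a_{n/2} − (α_{n/2} − s₁)²)`. -/
noncomputable def mPlus (m : ℕ) : ℝ :=
  let s1 := sN (2 * m) 1
  let αh := (sN (2 * m) (m + 1) + sN (2 * m) (m - 1)) / 4
  let βh := (3 / 2) * (sN (2 * m) m - s1)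
  let ah := (s1 + αh) ^ 2 - βh ^ 2
  let bh := 3 * (s1 + αh + βh)
  let b := 2 * (bh + αh - s1)
  let c := 4 * (ah - (αh - s1) ^ 2)
  b + Real.sqrt (b ^ 2 + c)

open Real Filter Topology Finset in
/-- Jordan's inequality on both halves of `[0, π]`, at the interior nodes `jπ/n`. -/
lemma two_div_le_sin_mul_pi_div {n j : ℕ} (h1 : 1 ≤ j) (h2 : j < n) :
    2 / (n : ℝ) ≤ sin ((j : ℝ) * π / n) := by
  have hn : (0 : ℝ) < n := by exact_mod_cast (by lia : 0 < n)
  have hj1 : (1 : ℝ) ≤ j := by exact_mod_cast h1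
  have hjn : (j : ℝ) + 1 ≤ n := by exact_mod_cast h2
  have hp := pi_pos
  rcases le_total (2 * (j : ℝ)) n with h | h
  · have h3 := mul_le_sin (x := (j : ℝ) * π / n) (by positivity)
      (by rw [div_le_div_iff₀ hn two_pos]; nlinarith)
    refine le_trans ?_ h3
    rw [show 2 / π * ((j : ℝ) * π / n) = 2 * j / n by field_simp]
    gcongr
    linarith
  · have h3 := mul_le_sin (x := ((n : ℝ) - j) * π / n)
      (div_nonneg (mul_nonneg (by linarith) hp.le) hn.le)
      (by rw [div_le_div_iff₀ hn two_pos]; nlinarith)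
    rw [show ((n : ℝ) - j) * π / n = π - j * π / n by field_simp, sin_pi_sub] at h3
    refine le_trans ?_ h3
    rw [show 2 / π * (π - (j : ℝ) * π / n) = 2 * (n - j) / n by field_simp]
    gcongr
    linarith

lemma sin_mul_pi_div_pos {n j : ℕ} (h1 : 1 ≤ j) (h2 : j < n) :
    0 < Real.sin ((j : ℝ) * Real.pi / n) :=
  lt_of_lt_of_le (div_pos two_pos (by exact_mod_cast (by lia : 0 < n)))
    (two_div_le_sin_mul_pi_div h1 h2)

lemma sN_nonneg (n k : ℕ) : 0 ≤ sN n k := by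
  unfold sN
  refine mul_nonneg (by norm_num) (Finset.sum_nonneg fun j hj => ?_)
  rw [Finset.mem_Ico] at hj
  have := sin_mul_pi_div_pos hj.1 hj.2
  positivity

lemma sN_one_le (n : ℕ) : sN n 1 ≤ (n : ℝ) ^ 2 := by
  have key : ∀ j ∈ Finset.Ico 1 n, Real.sin (((1 : ℕ) : ℝ) * j * Real.pi / n) ^ 2 /
      Real.sin ((j : ℝ) * Real.pi / n) ^ 3 ≤ n := by
    intro j hj
    rw [Finset.mem_Ico] at hj
    have h0 := sin_mul_pi_div_pos hj.1 hj.2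
    have h1 := two_div_le_sin_mul_pi_div hj.1 hj.2
    have hn : (0 : ℝ) < n := by exact_mod_cast (by lia : 0 < n)
    rw [Nat.cast_one, one_mul, div_le_iff₀ (by positivity)]
    rw [div_le_iff₀ hn] at h1
    nlinarith [sq_nonneg (Real.sin ((j : ℝ) * Real.pi / n))]
  have h := Finset.sum_le_card_nsmul _ _ _ key
  rw [Nat.card_Ico, nsmul_eq_mul] at h
  have h2 : ((n - 1 : ℕ) : ℝ) ≤ n := by exact_mod_cast Nat.sub_le n 1
  have h3 : (0 : ℝ) ≤ n := Nat.cast_nonneg n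
  unfold sN
  nlinarith

/-- A unit shift of the index `n/2` changes `s_{n/2}` by at most `s₁`. -/
lemma abs_sN_sub_sN_half_le {m k : ℕ} {e : ℝ} (he : e ^ 2 = 1) (hk : (k : ℝ) = m + e) :
    |sN (2 * m) k - sN (2 * m) m| ≤ sN (2 * m) 1 := by
  unfold sN
  rw [← mul_sub, ← Finset.sum_sub_distrib, abs_mul, abs_of_pos (by norm_num : (0 : ℝ) < 1 / 4)]
  refine mul_le_mul_of_nonneg_left ?_ (by norm_num)
  refine (Finset.abs_sum_le_sum_abs _ _).trans (Finset.sum_le_sum fun j hj => ?_)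
  rw [Finset.mem_Ico] at hj
  have h0 := sin_mul_pi_div_pos hj.1 hj.2
  have hm : (m : ℝ) ≠ 0 := by
    have : m ≠ 0 := by lia
    exact_mod_cast this
  rw [← sub_div, abs_div, abs_of_pos (by positivity :
    0 < Real.sin ((j : ℝ) * Real.pi / (2 * m : ℕ)) ^ 3), Nat.cast_one, one_mul]
  refine div_le_div_of_nonneg_right ?_ (by positivity)
  set y := (j : ℝ) * Real.pi / (2 * m : ℕ) with hy
  set x := (m : ℝ) * j * Real.pi / (2 * m : ℕ) with hx
  have hkx : (k : ℝ) * j * Real.pi / (2 * m : ℕ) = x + e * y := by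
    rw [hx, hy, hk]; ring
  have hsc : Real.sin x * Real.cos x = 0 := by
    have h2 : 2 * x = j * Real.pi := by
      rw [hx]; push_cast; field_simp
    have := Real.sin_nat_mul_pi j
    rw [← h2, Real.sin_two_mul] at this
    linarith
  have hsy : Real.sin (e * y) ^ 2 = Real.sin y ^ 2 := by
    rcases mul_self_eq_one_iff.mp ((sq e).symm.trans he) with h | h <;> simp [h]
  have hcy : Real.cos (e * y) ^ 2 = 1 - Real.sin y ^ 2 := by
    rw [Real.cos_sq', hsy]
  have heq : Real.sin (x + e * y) ^ 2 - Real.sin x ^ 2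
      = Real.sin y ^ 2 * (Real.cos x ^ 2 - Real.sin x ^ 2) := by
    rw [Real.sin_add]
    linear_combination Real.sin x ^ 2 * hcy + Real.cos x ^ 2 * hsy
      + 2 * Real.cos (e * y) * Real.sin (e * y) * hsc
  rw [hkx, heq, abs_mul, abs_of_nonneg (sq_nonneg (Real.sin y))]
  refine mul_le_of_le_one_right (sq_nonneg _) (abs_le.mpr ⟨?_, ?_⟩) <;>
    nlinarith [Real.sin_sq_add_cos_sq x, sq_nonneg (Real.sin x), sq_nonneg (Real.cos x)]

lemma sum_range_two_mul (g : ℕ → ℝ) (m : ℕ) :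
    ∑ j ∈ Finset.range (2 * m), g j = ∑ k ∈ Finset.range m, (g (2 * k) + g (2 * k + 1)) := by
  induction m with
  | zero => simp
  | succ m ih =>
    rw [Finset.sum_range_succ, ← ih, mul_add, mul_one, Finset.sum_range_succ,
      Finset.sum_range_succ]
    ring

lemma sN_half_eq (m : ℕ) : sN (2 * m) m = (1 / 4) * ∑ k ∈ Finset.range m,
    1 / Real.sin ((2 * (k : ℝ) + 1) * Real.pi / (2 * m)) ^ 3 := by
  unfold sN
  congr 1
  have h0 : ∑ j ∈ Finset.Ico 1 (2 * m), Real.sin ((m : ℝ) * j * Real.pi / (2 * m : ℕ)) ^ 2 /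
      Real.sin ((j : ℝ) * Real.pi / (2 * m : ℕ)) ^ 3 =
      ∑ j ∈ Finset.range (2 * m), Real.sin ((m : ℝ) * j * Real.pi / (2 * m : ℕ)) ^ 2 /
      Real.sin ((j : ℝ) * Real.pi / (2 * m : ℕ)) ^ 3 := by
    refine Finset.sum_subset (fun j hj => ?_) (fun j hj hj' => ?_)
    · simp only [Finset.mem_Ico, Finset.mem_range] at *; lia
    · have : j = 0 := by
        simp only [Finset.mem_Ico, Finset.mem_range] at *; lia
      simp [this]
  rw [h0, sum_range_two_mul]
  refine Finset.sum_congr rfl fun k hk => ?_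
  have hm : (m : ℝ) ≠ 0 := by
    have : m ≠ 0 := by rw [Finset.mem_range] at hk; lia
    exact_mod_cast this
  have h1 : (m : ℝ) * (2 * k : ℕ) * Real.pi / (2 * m : ℕ) = k * Real.pi := by
    push_cast; field_simp
  have h2 : (m : ℝ) * (2 * k + 1 : ℕ) * Real.pi / (2 * m : ℕ) = k * Real.pi + Real.pi / 2 := by
    push_cast; field_simp
  rw [h1, h2, Real.sin_nat_mul_pi, Real.sin_add_pi_div_two, Real.cos_sq', Real.sin_nat_mul_pi]
  push_cast
  simp

/-- The half-angle weight obtained from the smoothstep partition of unity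
`c⁴ (1 + 2 s²) + s⁴ (1 + 2 c²) = 1`, which moves the mass of `1 / sin³` to the endpoint `0`. -/
lemma one_div_sin_two_mul_cube {y : ℝ} (hs : Real.sin y ≠ 0) (hc : Real.cos y ≠ 0) :
    1 / Real.sin (2 * y) ^ 3 = Real.cos y * (1 + 2 * Real.sin y ^ 2) / (8 * Real.sin y ^ 3)
      + Real.sin y * (1 + 2 * Real.cos y ^ 2) / (8 * Real.cos y ^ 3) := by
  rw [Real.sin_two_mul]
  have h : (Real.sin y ^ 2 + Real.cos y ^ 2) = 1 := Real.sin_sq_add_cos_sq y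
  have h1 : Real.cos y ^ 4 * (1 + 2 * Real.sin y ^ 2)
      + Real.sin y ^ 4 * (1 + 2 * Real.cos y ^ 2) = 1 := by
    have h2 : Real.cos y ^ 2 = 1 - Real.sin y ^ 2 := by linarith
    rw [show Real.cos y ^ 4 = (Real.cos y ^ 2) ^ 2 by ring, h2]
    ring
  field_simp
  linear_combination (-8) * h1

lemma sN_half_eq_weighted (m : ℕ) : sN (2 * m) m = (1 / 2) * ∑ k ∈ Finset.range m,
    Real.cos ((2 * (k : ℝ) + 1) * Real.pi / (4 * m)) *
      (1 + 2 * Real.sin ((2 * (k : ℝ) + 1) * Real.pi / (4 * m)) ^ 2) /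
      (8 * Real.sin ((2 * (k : ℝ) + 1) * Real.pi / (4 * m)) ^ 3) := by
  set f : ℕ → ℝ := fun k => Real.cos ((2 * (k : ℝ) + 1) * Real.pi / (4 * m)) *
      (1 + 2 * Real.sin ((2 * (k : ℝ) + 1) * Real.pi / (4 * m)) ^ 2) /
      (8 * Real.sin ((2 * (k : ℝ) + 1) * Real.pi / (4 * m)) ^ 3) with hf
  have key : ∀ k ∈ Finset.range m,
      1 / Real.sin ((2 * (k : ℝ) + 1) * Real.pi / (2 * m)) ^ 3 = f k + f (m - 1 - k) := by
    intro k hk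
    rw [Finset.mem_range] at hk
    have hkm : (k : ℝ) + 1 ≤ m := by exact_mod_cast hk
    have hk0 : (0 : ℝ) ≤ k := Nat.cast_nonneg k
    have hm : (0 : ℝ) < m := by linarith
    have hp := Real.pi_pos
    have hcast : ((m - 1 - k : ℕ) : ℝ) = m - 1 - k := by
      rw [Nat.cast_sub (by lia), Nat.cast_sub (by lia), Nat.cast_one]
    have hrefl : (2 * ((m : ℝ) - 1 - k) + 1) * Real.pi / (4 * m)
        = Real.pi / 2 - (2 * (k : ℝ) + 1) * Real.pi / (4 * m) := by
      field_simp; ring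
    have hlt : (2 * (k : ℝ) + 1) * Real.pi / (4 * m) < Real.pi / 2 := by
      rw [div_lt_div_iff₀ (by positivity) two_pos]
      nlinarith
    have hpos : 0 < (2 * (k : ℝ) + 1) * Real.pi / (4 * m) := by positivity
    simp only [hf]
    rw [hcast, hrefl, Real.cos_pi_div_two_sub, Real.sin_pi_div_two_sub,
      ← one_div_sin_two_mul_cube (Real.sin_pos_of_pos_of_lt_pi hpos (by linarith)).ne'
        (Real.cos_pos_of_mem_Ioo ⟨by linarith, hlt⟩).ne']
    congr 3
    field_simp
    norm_num
  rw [sN_half_eq, Finset.sum_congr rfl key, Finset.sum_add_distrib, Finset.sum_range_reflect]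
  ring

lemma summable_one_div_odd_cube : Summable fun k : ℕ => 1 / (2 * (k : ℝ) + 1) ^ 3 := by
  have h := (summable_nat_add_iff 1).mpr (Real.summable_one_div_nat_pow.mpr (by norm_num : 1 < 3))
  refine h.of_nonneg_of_le (fun k => by positivity) fun k => ?_
  push_cast
  gcongr
  linarith [(Nat.cast_nonneg k : (0 : ℝ) ≤ k)]

open Real Filter Topology in
lemma tendsto_mul_sin_div_atTop (a : ℝ) :
    Tendsto (fun m : ℕ => (m : ℝ) * sin (a / m)) atTop (𝓝 a) := by
  have h1 : Tendsto (fun m : ℕ => sinc (a / m)) atTop (𝓝 1) := by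
    have := (continuous_sinc.tendsto 0).comp (tendsto_const_div_atTop_nhds_zero_nat a)
    rwa [sinc_zero] at this
  have h2 := h1.const_mul a
  rw [mul_one] at h2
  refine h2.congr' ?_
  filter_upwards [eventually_gt_atTop 0] with m hm
  have hm' : (m : ℝ) ≠ 0 := by exact_mod_cast hm.ne'
  rcases eq_or_ne a 0 with rfl | ha
  · simp
  · rw [sinc_of_ne_zero (by positivity)]
    field_simp

open Real Filter Topology in
lemma tendsto_sN_half :
    Tendsto (fun m : ℕ => sN (2 * m) m / (2 * (m : ℝ)) ^ 3) atTop (𝓝 sigmaConst) := by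
  set F : ℕ → ℕ → ℝ := fun m k => if k < m then
    cos ((2 * (k : ℝ) + 1) * π / (4 * m)) * (1 + 2 * sin ((2 * (k : ℝ) + 1) * π / (4 * m)) ^ 2) /
      (64 * ((m : ℝ) * sin ((2 * (k : ℝ) + 1) * π / (4 * m))) ^ 3) else 0 with hF
  have hlim : Tendsto (fun m => ∑' k, F m k) atTop
      (𝓝 (∑' k : ℕ, 1 / π ^ 3 * (1 / (2 * (k : ℝ) + 1) ^ 3))) := by
    refine tendsto_tsum_of_dominated_convergence
      (bound := fun k : ℕ => 3 * (1 / (2 * (k : ℝ) + 1) ^ 3))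
      (summable_one_div_odd_cube.mul_left 3) (fun k => ?_) (Eventually.of_forall fun m k => ?_)
    · set a := (2 * (k : ℝ) + 1) * π / 4 with ha
      have ha0 : 0 < a := by positivity
      have hdiv : ∀ m : ℕ, (2 * (k : ℝ) + 1) * π / (4 * m) = a / m := fun m => by
        rw [ha, div_div]
      have h0 := tendsto_const_div_atTop_nhds_zero_nat a
      have hc := (continuous_cos.tendsto 0).comp h0
      have hs := (continuous_sin.tendsto 0).comp h0
      rw [cos_zero] at hc
      rw [sin_zero] at hs
      have h := (hc.mul (((hs.pow 2).const_mul 2).const_add 1)).div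
        (((tendsto_mul_sin_div_atTop a).pow 3).const_mul 64) (by positivity)
      rw [show 1 * (1 + 2 * (0 : ℝ) ^ 2) / (64 * a ^ 3)
        = 1 / π ^ 3 * (1 / (2 * (k : ℝ) + 1) ^ 3) by rw [ha]; field_simp; norm_num] at h
      refine h.congr' ?_
      filter_upwards [eventually_gt_atTop k] with m hm
      simp [hF, hm, hdiv]
    · simp only [hF]
      split_ifs with hkm
      · have hkm' : (k : ℝ) + 1 ≤ m := by exact_mod_cast hkm
        have hk0 : (0 : ℝ) ≤ k := Nat.cast_nonneg k
        have hm : (0 : ℝ) < m := by linarith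
        have hp := pi_pos
        set y := (2 * (k : ℝ) + 1) * π / (4 * m) with hy
        have hle : y ≤ π / 2 := by
          rw [hy, div_le_div_iff₀ (by positivity) two_pos]
          nlinarith
        have hy0 : 0 ≤ y := by positivity
        have hc0 : 0 ≤ cos y := cos_nonneg_of_mem_Icc ⟨by linarith, hle⟩
        have hs : (2 * (k : ℝ) + 1) / 2 ≤ m * sin y := by
          have h := mul_le_mul_of_nonneg_left (mul_le_sin hy0 hle) hm.le
          rwa [show (m : ℝ) * (2 / π * y) = (2 * (k : ℝ) + 1) / 2 by
            rw [hy]; field_simp; norm_num] at h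
        have hs0 : 0 < (m : ℝ) * sin y := lt_of_lt_of_le (by positivity) hs
        rw [norm_of_nonneg (by positivity)]
        have hnum : cos y * (1 + 2 * sin y ^ 2) ≤ 3 := by
          have := cos_le_one y
          have := sin_sq_le_one y
          nlinarith [sq_nonneg (sin y)]
        calc _ ≤ 3 / (64 * ((2 * (k : ℝ) + 1) / 2) ^ 3) := by gcongr
          _ = 3 / 8 * (1 / (2 * (k : ℝ) + 1) ^ 3) := by field_simp; norm_num
          _ ≤ _ := by gcongr; norm_num
      · rw [norm_zero]; positivity
  have h := hlim.const_mul (1 / 2)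
  rw [tsum_mul_left, show 1 / 2 * (1 / π ^ 3 * ∑' k : ℕ, 1 / (2 * (k : ℝ) + 1) ^ 3) = sigmaConst by
    unfold sigmaConst; field_simp] at h
  refine h.congr fun m => ?_
  rw [sN_half_eq_weighted, tsum_eq_sum (s := Finset.range m)
    (fun k hk => by simp only [Finset.mem_range] at hk; simp [hF, hk]), mul_div_assoc,
    Finset.sum_div]
  congr 1
  refine Finset.sum_congr rfl fun k hk => ?_
  rw [Finset.mem_range] at hk
  simp only [hF, hk, if_true]
  rw [div_div]
  congr 1
  ring

open Real Filter Topology in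
lemma tendsto_sN_one :
    Tendsto (fun m : ℕ => sN (2 * m) 1 / (2 * (m : ℝ)) ^ 3) atTop (𝓝 0) := by
  refine squeeze_zero' (Eventually.of_forall fun m => div_nonneg (sN_nonneg _ _) (by positivity))
    ?_ (tendsto_const_div_atTop_nhds_zero_nat (1 / 2))
  filter_upwards [eventually_gt_atTop 0] with m hm
  have hm' : (0 : ℝ) < m := by exact_mod_cast hm
  have h := sN_one_le (2 * m)
  push_cast at h
  calc _ ≤ (2 * (m : ℝ)) ^ 2 / (2 * (m : ℝ)) ^ 3 := by gcongr
    _ = 1 / 2 / m := by field_simp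

open Real Filter Topology in
lemma tendsto_sN_shift (k : ℕ → ℕ) {e : ℝ} (he : e ^ 2 = 1)
    (hk : ∀ᶠ m : ℕ in atTop, (k m : ℝ) = m + e) :
    Tendsto (fun m : ℕ => sN (2 * m) (k m) / (2 * (m : ℝ)) ^ 3) atTop (𝓝 sigmaConst) := by
  have h : Tendsto (fun m : ℕ => sN (2 * m) (k m) / (2 * (m : ℝ)) ^ 3
      - sN (2 * m) m / (2 * (m : ℝ)) ^ 3) atTop (𝓝 0) := by
    refine squeeze_zero_norm' ?_ tendsto_sN_one
    filter_upwards [hk] with m hm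
    rw [← sub_div, norm_eq_abs, abs_div, abs_of_nonneg (by positivity : 0 ≤ (2 * (m : ℝ)) ^ 3)]
    exact div_le_div_of_nonneg_right (abs_sN_sub_sN_half_le he hm) (by positivity)
  simpa using h.add tendsto_sN_half

/-- `mPlus` is homogeneous of degree one in the sums `s_k`, so the scaling by `n³` can be carried
out on each of them. -/
lemma mPlus_div {m : ℕ} {N : ℝ} (hN : 0 < N) : mPlus m / N =
    (let s1 := sN (2 * m) 1 / N
     let αh := (sN (2 * m) (m + 1) / N + sN (2 * m) (m - 1) / N) / 4
     let βh := (3 / 2) * (sN (2 * m) m / N - s1)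
     let ah := (s1 + αh) ^ 2 - βh ^ 2
     let bh := 3 * (s1 + αh + βh)
     let b := 2 * (bh + αh - s1)
     let c := 4 * (ah - (αh - s1) ^ 2)
     b + Real.sqrt (b ^ 2 + c)) := by
  simp only [mPlus]
  rw [add_div]
  congr 1
  · ring
  · rw [← Real.sqrt_sq hN.le, ← Real.sqrt_div' _ (sq_nonneg N), Real.sqrt_sq hN.le]
    congr 1
    field_simp

lemma sigmaConst_nonneg : 0 ≤ sigmaConst :=
  mul_nonneg (by have := Real.pi_pos; positivity) (tsum_nonneg fun k => by positivity)

/-- **Saturn's-rings estimate.** As `n = 2m → ∞` through even integers,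
`m₊/n³ → (13 + 4√10) σ` where `σ = (1/(2π³)) ∑_{k≥1} 1/(2k−1)³`. -/
theorem mPlus_asymptotics :
    Filter.Tendsto (fun m : ℕ => mPlus m / (2 * (m : ℝ)) ^ 3)
      Filter.atTop (nhds ((13 + 4 * Real.sqrt 10) * sigmaConst)) := by
  have hs1 := tendsto_sN_one
  have hh := tendsto_sN_half
  have hp := tendsto_sN_shift (fun m => m + 1) (e := 1) (by norm_num)
    (Filter.Eventually.of_forall fun m => by push_cast; ring)
  have hm := tendsto_sN_shift (fun m => m - 1) (e := -1) (by norm_num) (by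
    filter_upwards [Filter.eventually_ge_atTop 1] with m hm
    rw [Nat.cast_sub hm, Nat.cast_one, sub_eq_add_neg])
  have hα := (hp.add hm).div_const 4
  have hβ := (hh.sub hs1).const_mul (3 / 2)
  have ha := ((hs1.add hα).pow 2).sub (hβ.pow 2)
  have hbh := ((hs1.add hα).add hβ).const_mul 3
  have hb := ((hbh.add hα).sub hs1).const_mul 2
  have hc := (ha.sub ((hα.sub hs1).pow 2)).const_mul 4
  have h := hb.add ((hb.pow 2).add hc).sqrt
  have hlim : (13 + 4 * Real.sqrt 10) * sigmaConst = 13 * sigmaConst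
      + Real.sqrt ((4 * sigmaConst) ^ 2 * 10) := by
    rw [Real.sqrt_mul (sq_nonneg _),
      Real.sqrt_sq (mul_nonneg (by norm_num) sigmaConst_nonneg)]
    ring
  rw [hlim]
  convert h.congr' ?_ using 2
  · congr 1
    · ring
    · congr 1
      ring
  · filter_upwards [Filter.eventually_gt_atTop 0] with m hm
    have hm' : (0 : ℝ) < m := by exact_mod_cast hm
    rw [mPlus_div (by positivity : 0 < (2 * (m : ℝ)) ^ 3)]
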